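/- Let M be a matroid on a finite ground set U that is not the free matroid (i.e., 𝒞(M) ≠ ∅). Then M is disconnected if and only if there exists a nonempty proper subset X ⊂ U such that overline{R(M)}(X) ⊆ X. -/

import Mathlib

open Set

/-- A circuit of a matroid `M`: a minimal dependent subset of the ground set. -/
def IsCircuit {α : Type*} (M : Matroid α) (C : Set α) : Prop :=
  M.Dep C ∧ ∀ D, D ⊂ C → M.Indep D

/-- The relation `R(M)` induced from the matroid `M`:
`x R(M) y` iff there is a circuit of `M` containing both `x` and `y`. -/
def matroidRel {α : Type*} (M : Matroid α) (x y : α) : Prop :=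
  ∃ C, IsCircuit M C ∧ x ∈ C ∧ y ∈ C

/-- The successor neighborhood `R(M)N(x) = {y | x R(M) y}`. -/
def nbhd {α : Type*} (M : Matroid α) (x : α) : Set α :=
  {y | matroidRel M x y}

/-- The upper approximation of `X` with respect to `R(M)`. -/
def upperApprox {α : Type*} (M : Matroid α) (X : Set α) : Set α :=
  {x | (nbhd M x ∩ X).Nonempty}

/-- A matroid (with ground set the whole type) is connected iff every pair of
distinct elements lies in a common circuit. -/
def MatroidConnected {α : Type*} (M : Matroid α) : Prop :=
  ∀ x y : α, x ≠ y → ∃ C, IsCircuit M C ∧ x ∈ C ∧ y ∈ C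

/-- If two intersecting circuits of a matroid on a finite type contain `x` and `z` respectively,
then some circuit contains both `x` and `z`. -/
theorem Matroid.IsCircuit.exists_isCircuit_mem_mem {α : Type*} [Finite α] {M : Matroid α}
    {C₁ C₂ : Set α} {x z : α} (hC₁ : M.IsCircuit C₁) (hC₂ : M.IsCircuit C₂) (hx : x ∈ C₁)
    (hz : z ∈ C₂) (hne : (C₁ ∩ C₂).Nonempty) : ∃ C, M.IsCircuit C ∧ x ∈ C ∧ z ∈ C := by
  induction hU : C₁ ∪ C₂ using WellFoundedLT.induction generalizing C₁ C₂ with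
  | ind U ih =>
    subst hU
    by_cases hxC₂ : x ∈ C₂
    · exact ⟨C₂, hC₂, hxC₂, hz⟩
    by_cases hzC₁ : z ∈ C₁
    · exact ⟨C₁, hC₁, hx, hzC₁⟩
    obtain ⟨e, he₁, he₂⟩ := hne
    obtain ⟨C₃, hC₃U, hC₃, hxC₃⟩ := hC₁.strong_elimination hC₂ he₁ he₂ hx hxC₂
    obtain ⟨C₄, hC₄U, hC₄, hzC₄⟩ := hC₂.strong_elimination hC₁ he₂ he₁ hz hzC₁
    have hC₃₂ : (C₃ ∩ C₂).Nonempty := by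
      by_contra h
      have hsub : C₃ ⊆ C₁ := fun a ha ↦
        (hC₃U ha).1.resolve_right fun h₂ ↦ h ⟨a, ha, h₂⟩
      exact (hC₃U (hC₃.eq_of_subset_isCircuit hC₁ hsub ▸ he₁)).2 rfl
    have hle : C₃ ∪ C₂ ⊆ C₁ ∪ C₂ :=
      union_subset (hC₃U.trans sdiff_subset) subset_union_right
    obtain heq | hlt := hle.eq_or_ssubset
    · have hC₃₄ : (C₃ ∩ C₄).Nonempty := by
        by_contra h
        have hsub : C₄ ⊆ C₂ := fun a ha ↦
          (heq.symm ▸ union_comm C₂ C₁ ▸ (hC₄U ha).1 : a ∈ C₃ ∪ C₂).resolve_left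
            fun h₃ ↦ h ⟨a, h₃, ha⟩
        exact (hC₄U (hC₄.eq_of_subset_isCircuit hC₂ hsub ▸ he₂)).2 rfl
      have heU : C₃ ∪ C₄ ⊆ (C₁ ∪ C₂) \ {e} :=
        union_subset hC₃U (union_comm C₂ C₁ ▸ hC₄U)
      exact ih _ (heU.trans_ssubset (sdiff_singleton_ssubset.2 (.inl he₁)))
        hC₃ hC₄ hxC₃ hzC₄ hC₃₄ rfl
    · exact ih _ hlt hC₃ hC₂ hxC₃ hz hC₃₂ rfl

theorem isCircuit_iff_matroid_isCircuit {α : Type*} {M : Matroid α} {C : Set α} :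
    IsCircuit M C ↔ M.IsCircuit C :=
  Matroid.isCircuit_iff_forall_ssubset.symm

theorem matroidRel.symm {α : Type*} {M : Matroid α} {x y : α} (h : matroidRel M x y) :
    matroidRel M y x :=
  let ⟨C, hC, hx, hy⟩ := h
  ⟨C, hC, hy, hx⟩

theorem matroidRel.trans {α : Type*} [Finite α] {M : Matroid α} {x y z : α}
    (hxy : matroidRel M x y) (hyz : matroidRel M y z) : matroidRel M x z := by
  obtain ⟨C₁, hC₁, hx, hy₁⟩ := hxy
  obtain ⟨C₂, hC₂, hy₂, hz⟩ := hyz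
  rw [isCircuit_iff_matroid_isCircuit] at hC₁ hC₂
  simpa only [matroidRel, isCircuit_iff_matroid_isCircuit] using
    hC₁.exists_isCircuit_mem_mem hC₂ hx hz ⟨y, hy₁, hy₂⟩

theorem matroidDisconnected_iff_exists_upperApprox_subset {α : Type*} [Fintype α]
    (M : Matroid α) (hE : M.E = Set.univ) (hM : {C | IsCircuit M C}.Nonempty) :
    ¬ MatroidConnected M ↔
      ∃ X : Set α, X.Nonempty ∧ X ⊂ Set.univ ∧ upperApprox M X ⊆ X := by
  constructor
  · intro h
    simp only [MatroidConnected, not_forall] at h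
    obtain ⟨x, y, hxy, hnot⟩ := h
    refine ⟨insert x (nbhd M x), insert_nonempty _ _, ?_, ?_⟩
    · refine ssubset_univ_iff.2 fun h ↦ ?_
      obtain hyx | hy := (h ▸ mem_univ y : y ∈ insert x (nbhd M x))
      · exact hxy hyx.symm
      · exact hnot hy
    · rintro w ⟨v, hwv, rfl | hxv⟩
      · exact .inr (matroidRel.symm hwv)
      · exact .inr (matroidRel.trans hxv (matroidRel.symm hwv))
  · rintro ⟨X, ⟨x, hx⟩, hX, hsub⟩ hconn
    obtain ⟨y, -, hy⟩ := exists_of_ssubset hX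
    exact hy (hsub ⟨x, hconn y x fun h ↦ hy (h ▸ hx), hx⟩)
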